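/- Let d ≥ 1, L > 0, N ∈ ℕ and let 𝑣 = (v_1,…,v_N) be a volume vector with ∑_i v_i = L^d. Let G be a lattice with d(G) = L^d, D a fundamental domain for G and (E_1,…,E_N) a partition of D with |E_i| = v_i, which together minimize inf_G inf_D inf{ (1/2)·∑_i Per_K(E_i) } over all lattices G with d(G) = L^d, fundamental domains D and partitions (E_i ⊆ D, |E_i| = v_i, |E_i ∩ E_j| = 0 for i ≠ j, |D ∖ ⋃_i E_i| = 0), where Per_K is the nonlocal perimeter. Then the countable partition (E_i + g)_{1 ≤ i ≤ N, g ∈ G} of ℝ^d is a volume-constrained (Λ,r)-minimal partition for Per_K, for every r < ρ_G/2, with Λ := ∫_{ℝ^d∖B_{ρ_G−2r}(0)} K(x) dx. -/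

import Mathlib

open MeasureTheory Filter Topology
open scoped symmDiff ENNReal

noncomputable section

variable {d : ℕ}

abbrev Vd (d : ℕ) := EuclideanSpace ℝ (Fin d)

def nlPer (K : Vd d → ℝ≥0∞) (E : Set (Vd d)) : ℝ≥0∞ :=
  ∫⁻ x in E, ∫⁻ y in Eᶜ, K (x - y)

def nlPerRel (K : Vd d → ℝ≥0∞) (E Ω : Set (Vd d)) : ℝ≥0∞ :=
  (∫⁻ x in E ∩ Ω, ∫⁻ y in Eᶜ, K (x - y)) + (∫⁻ x in E \ Ω, ∫⁻ y in Ω \ E, K (x - y))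

def IsKernelBase (K : Vd d → ℝ≥0∞) : Prop :=
  Measurable K ∧ (∀ x, K (-x) = K x) ∧ (∫⁻ x, ENNReal.ofReal (min 1 ‖x‖) * K x) < ⊤

def IsKernel (s C : ℝ) (K : Vd d → ℝ≥0∞) : Prop :=
  IsKernelBase K ∧ ∀ x : Vd d, x ≠ 0 → ENNReal.ofReal (C * ‖x‖ ^ (-(d : ℝ) - s)) ≤ K x

def latticeOf (b : Fin d → Vd d) : Set (Vd d) :=
  {x | ∃ k : Fin d → ℤ, x = ∑ i, (k i : ℝ) • b i}

def IsLattice (G : Set (Vd d)) : Prop :=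
  ∃ b : Fin d → Vd d, LinearIndependent ℝ b ∧ G = latticeOf b

def IsLatticeWithVol (G : Set (Vd d)) (vol : ℝ) : Prop :=
  ∃ b : Fin d → Vd d, LinearIndependent ℝ b ∧ G = latticeOf b ∧
    |Matrix.det (Matrix.of fun i j => b j i)| = vol

def setTranslate (g : Vd d) (A : Set (Vd d)) : Set (Vd d) := (fun x => x + g) '' A

def IsFundDom (G : Set (Vd d)) (D : Set (Vd d)) : Prop :=
  MeasurableSet D ∧ (∀ g ∈ G, g ≠ 0 → volume (setTranslate g D ∩ D) = 0) ∧
    volume (Set.univ \ ⋃ g ∈ G, setTranslate g D) = 0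

def packingRadius (G : Set (Vd d)) : ℝ :=
  sSup {r : ℝ | 0 < r ∧ ∀ g₁ ∈ G, ∀ g₂ ∈ G, g₁ ≠ g₂ →
    Disjoint (Metric.ball g₁ r) (Metric.ball g₂ r)}

def phiK (K : Vd d → ℝ≥0∞) (t : ℝ) : ℝ≥0∞ := ∫⁻ x in (Metric.ball (0 : Vd d) t)ᶜ, K x

def setDist (A B : Set (Vd d)) : ℝ := sInf ((fun p : Vd d × Vd d => dist p.1 p.2) '' (A ×ˢ B))

def TendstoL1loc (E : ℕ → Set (Vd d)) (F : Set (Vd d)) : Prop :=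
  ∀ R : ℝ, 0 < R → Tendsto (fun n => volume ((E n ∆ F) ∩ Metric.ball 0 R)) atTop (𝓝 0)

def AdmissiblePart (D : Set (Vd d)) {N : ℕ} (v : Fin N → ℝ) (E : Fin N → Set (Vd d)) : Prop :=
  (∀ i, MeasurableSet (E i)) ∧ (∀ i, E i ⊆ D) ∧
  (∀ i, volume (E i) = ENNReal.ofReal (v i)) ∧
  (∀ i j, i ≠ j → volume (E i ∩ E j) = 0) ∧
  volume (D \ ⋃ i, E i) = 0

def AdmissiblePart₀ (D : Set (Vd d)) {N : ℕ} (E : Fin N → Set (Vd d)) : Prop :=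
  (∀ i, MeasurableSet (E i)) ∧ (∀ i, E i ⊆ D) ∧
  (∀ i j, i ≠ j → volume (E i ∩ E j) = 0) ∧
  volume (D \ ⋃ i, E i) = 0

def ediff (a b : ℝ≥0∞) : ℝ≥0∞ := (a - b) + (b - a)

def IsPartition {J : Type*} (A : J → Set (Vd d)) : Prop :=
  (∀ j, MeasurableSet (A j)) ∧ (∀ j j', j ≠ j' → volume (A j ∩ A j') = 0) ∧
  volume (Set.univ \ ⋃ j, A j) = 0

def ComptContained (S Ω : Set (Vd d)) : Prop := IsCompact (closure S) ∧ closure S ⊆ Ω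

def IsVolConstrMin (K : Vd d → ℝ≥0∞) (Λ : ℝ≥0∞) (Ω : Set (Vd d))
    {J : Type*} (A : J → Set (Vd d)) : Prop :=
  (∑' j, nlPerRel K (A j) Ω) ≠ ⊤ ∧
  ∀ B : J → Set (Vd d), IsPartition B →
    (∀ j, ComptContained (A j ∆ B j) Ω) →
    (∀ j, volume (A j ∩ Ω) = volume (B j ∩ Ω)) →
    (∑' j, nlPerRel K (A j) Ω) ≤ ∑' j, (nlPerRel K (B j) Ω + Λ * volume (A j ∆ B j))

def IsLamMin (K : Vd d → ℝ≥0∞) (Λ : ℝ≥0∞) (Ω : Set (Vd d))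
    {J : Type*} (A : J → Set (Vd d)) : Prop :=
  (∑' j, nlPerRel K (A j) Ω) ≠ ⊤ ∧
  ∀ B : J → Set (Vd d), IsPartition B →
    (∀ j, ComptContained (A j ∆ B j) Ω) →
    (∑' j, nlPerRel K (A j) Ω) ≤ ∑' j, (nlPerRel K (B j) Ω + Λ * volume (A j ∆ B j))


/-- The measure on `Vd d × Vd d` with density `K (x - y)`. -/
def kerMeasure (K : Vd d → ℝ≥0∞) : Measure (Vd d × Vd d) :=
  ((volume : Measure (Vd d)).prod volume).withDensity fun p => K (p.1 - p.2)

theorem kerMeasure_prod {K : Vd d → ℝ≥0∞} (hK : Measurable K) {A B : Set (Vd d)}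
    (hA : MeasurableSet A) (hB : MeasurableSet B) :
    kerMeasure K (A ×ˢ B) = ∫⁻ x in A, ∫⁻ y in B, K (x - y) := by
  have hm : Measurable fun p : Vd d × Vd d => K (p.1 - p.2) := by fun_prop
  rw [kerMeasure, withDensity_apply _ (hA.prod hB), ← Measure.prod_restrict,
    lintegral_prod _ hm.aemeasurable]

theorem nlPer_eq_kerMeasure {K : Vd d → ℝ≥0∞} (hK : Measurable K) {E : Set (Vd d)}
    (hE : MeasurableSet E) : nlPer K E = kerMeasure K (E ×ˢ Eᶜ) :=
  (kerMeasure_prod hK hE hE.compl).symm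

/-- The pairs of points at least one of which lies in `Ω`. -/
def pairsMeeting (Ω : Set (Vd d)) : Set (Vd d × Vd d) := {p | p.1 ∈ Ω ∨ p.2 ∈ Ω}

theorem measurableSet_pairsMeeting {Ω : Set (Vd d)} (hΩ : MeasurableSet Ω) :
    MeasurableSet (pairsMeeting Ω) :=
  (measurable_fst hΩ).union (measurable_snd hΩ)

theorem nlPerRel_eq_kerMeasure {K : Vd d → ℝ≥0∞} (hK : Measurable K) {E Ω : Set (Vd d)}
    (hE : MeasurableSet E) (hΩ : MeasurableSet Ω) :
    nlPerRel K E Ω = kerMeasure K (E ×ˢ Eᶜ ∩ pairsMeeting Ω) := by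
  rw [nlPerRel, ← kerMeasure_prod hK (hE.inter hΩ) hE.compl,
    ← kerMeasure_prod hK (hE.diff hΩ) (hΩ.diff hE),
    ← measure_union _ ((hE.diff hΩ).prod (hΩ.diff hE))]
  · congr 1
    ext p
    simp only [pairsMeeting, Set.mem_union, Set.mem_prod, Set.mem_inter_iff, Set.mem_sdiff,
      Set.mem_compl_iff, Set.mem_ofPred_eq]
    tauto
  · rw [Set.disjoint_left]
    rintro p ⟨⟨-, h1⟩, -⟩ ⟨⟨-, h2⟩, -⟩
    exact h2 h1

theorem kerMeasure_translate {K : Vd d → ℝ≥0∞} (hK : Measurable K) (g : Vd d)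
    {S : Set (Vd d × Vd d)} (hS : MeasurableSet S) :
    kerMeasure K {p | (p.1 + g, p.2 + g) ∈ S} = kerMeasure K S := by
  have hm : Measurable fun p : Vd d × Vd d => K (p.1 - p.2) := by fun_prop
  have hτ : MeasurePreserving (fun p : Vd d × Vd d => (p.1 + g, p.2 + g))
      ((volume : Measure (Vd d)).prod volume) (volume.prod volume) :=
    (measurePreserving_add_right volume g).prod (measurePreserving_add_right volume g)
  have hS' : MeasurableSet {p : Vd d × Vd d | (p.1 + g, p.2 + g) ∈ S} := hτ.measurable hS
  rw [kerMeasure, withDensity_apply _ hS', withDensity_apply _ hS,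
    ← hτ.setLIntegral_comp_preimage hS hm]
  simp only [add_sub_add_right_eq_sub]
  rfl

section Periodic

variable (H : AddSubgroup (Vd d)) (Ω : Set (Vd d))

/-- The pairs of points lying in two different translates of `Ω`. -/
def crossPairs : Set (Vd d × Vd d) :=
  {p | ∃ g h : H, g ≠ h ∧ p.1 + (g : Vd d) ∈ Ω ∧ p.2 + (h : Vd d) ∈ Ω}

/-- The pairs of points meeting exactly one translate of `Ω`. -/
def localPairs : Set (Vd d × Vd d) :=
  {p | (∃ g : H, p.1 + (g : Vd d) ∈ Ω ∨ p.2 + (g : Vd d) ∈ Ω) ∧ p ∉ crossPairs H Ω}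

variable {H Ω}

theorem measurableSet_crossPairs [Countable H] (hΩ : MeasurableSet Ω) :
    MeasurableSet (crossPairs H Ω) := by
  have h1 : ∀ g : H, MeasurableSet {p : Vd d × Vd d | p.1 + (g : Vd d) ∈ Ω} := fun g =>
    (measurable_fst.add_const (g : Vd d)) hΩ
  have h2 : ∀ g : H, MeasurableSet {p : Vd d × Vd d | p.2 + (g : Vd d) ∈ Ω} := fun g =>
    (measurable_snd.add_const (g : Vd d)) hΩ
  have heq : crossPairs H Ω = ⋃ (g : H) (h : H) (_ : g ≠ h),
      ({p | p.1 + (g : Vd d) ∈ Ω} ∩ {p | p.2 + (h : Vd d) ∈ Ω}) := by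
    ext p
    simp only [crossPairs, Set.mem_ofPred_eq, Set.mem_iUnion, Set.mem_inter_iff, exists_prop]
  rw [heq]
  exact .iUnion fun g => .iUnion fun h => .iUnion fun _ => (h1 g).inter (h2 h)

theorem measurableSet_localPairs [Countable H] (hΩ : MeasurableSet Ω) :
    MeasurableSet (localPairs H Ω) := by
  have h1 : ∀ g : H, MeasurableSet {p : Vd d × Vd d | p.1 + (g : Vd d) ∈ Ω} := fun g =>
    (measurable_fst.add_const (g : Vd d)) hΩ
  have h2 : ∀ g : H, MeasurableSet {p : Vd d × Vd d | p.2 + (g : Vd d) ∈ Ω} := fun g =>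
    (measurable_snd.add_const (g : Vd d)) hΩ
  have heq : localPairs H Ω = (⋃ g : H,
      ({p | p.1 + (g : Vd d) ∈ Ω} ∪ {p | p.2 + (g : Vd d) ∈ Ω})) \ crossPairs H Ω := by
    ext p
    simp [localPairs]
  rw [heq]
  exact (MeasurableSet.iUnion fun g => (h1 g).union (h2 g)).diff (measurableSet_crossPairs hΩ)

theorem tsum_nlPerRel_eq [Countable H] {K : Vd d → ℝ≥0∞} (hK : Measurable K)
    (hΩ : MeasurableSet Ω)
    (hdis : ∀ (g h : H) (y : Vd d), y + (g : Vd d) ∈ Ω → y + (h : Vd d) ∈ Ω → g = h)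
    {E F : Set (Vd d)} {B : H → Set (Vd d)} (hB : ∀ g, MeasurableSet (B g))
    (hFB : ∀ (g : H) (y : Vd d), y + (g : Vd d) ∈ Ω → (y ∈ F ↔ y + (g : Vd d) ∈ B g))
    (hFE : ∀ y : Vd d, (∀ g : H, y + (g : Vd d) ∉ Ω) → (y ∈ F ↔ y ∈ E))
    (hBE : ∀ (g : H) (y : Vd d), y + (g : Vd d) ∉ Ω → (y + (g : Vd d) ∈ B g ↔ y ∈ E)) :
    ∑' g : H, nlPerRel K (B g) Ω =
      kerMeasure K (F ×ˢ Fᶜ ∩ localPairs H Ω) + kerMeasure K (F ×ˢ Eᶜ ∩ crossPairs H Ω) +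
        kerMeasure K (E ×ˢ Fᶜ ∩ crossPairs H Ω) := by
  set τ : H → Vd d × Vd d → Vd d × Vd d := fun g p => (p.1 + (g : Vd d), p.2 + (g : Vd d)) with hτ
  have hτm : ∀ g, Measurable (τ g) := fun g => by fun_prop
  set S : H → Set (Vd d × Vd d) := fun g => τ g ⁻¹' (B g ×ˢ (B g)ᶜ) with hS
  have hSm : ∀ g, MeasurableSet (S g) := fun g => hτm g ((hB g).prod (hB g).compl)
  have hX : ∀ g : H, MeasurableSet {p : Vd d × Vd d | p.1 + (g : Vd d) ∈ Ω} := fun g =>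
    (measurable_fst.add_const (g : Vd d)) hΩ
  have hY : ∀ g : H, MeasurableSet {p : Vd d × Vd d | p.2 + (g : Vd d) ∈ Ω} := fun g =>
    (measurable_snd.add_const (g : Vd d)) hΩ
  have hLm := measurableSet_localPairs (H := H) hΩ
  have hCm := measurableSet_crossPairs (H := H) hΩ
  set S₁ : H → Set (Vd d × Vd d) := fun g =>
    S g ∩ (({p | p.1 + (g : Vd d) ∈ Ω} ∪ {p | p.2 + (g : Vd d) ∈ Ω}) ∩ localPairs H Ω) with hS₁
  set S₂ : H → Set (Vd d × Vd d) := fun g =>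
    S g ∩ ({p | p.1 + (g : Vd d) ∈ Ω} ∩ crossPairs H Ω) with hS₂
  set S₃ : H → Set (Vd d × Vd d) := fun g =>
    S g ∩ ({p | p.2 + (g : Vd d) ∈ Ω} ∩ crossPairs H Ω) with hS₃
  have hm₁ : ∀ g, MeasurableSet (S₁ g) := fun g =>
    (hSm g).inter (((hX g).union (hY g)).inter hLm)
  have hm₂ : ∀ g, MeasurableSet (S₂ g) := fun g => (hSm g).inter ((hX g).inter hCm)
  have hm₃ : ∀ g, MeasurableSet (S₃ g) := fun g => (hSm g).inter ((hY g).inter hCm)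
  have hsplit : ∀ g : H, nlPerRel K (B g) Ω =
      kerMeasure K (S₁ g) + kerMeasure K (S₂ g) + kerMeasure K (S₃ g) := by
    intro g
    rw [nlPerRel_eq_kerMeasure hK (hB g) hΩ,
      ← kerMeasure_translate hK (g : Vd d)
        (((hB g).prod (hB g).compl).inter (measurableSet_pairsMeeting hΩ)),
      ← measure_union _ (hm₂ g), ← measure_union _ (hm₃ g)]
    · congr 1
      ext p
      have key : p ∉ localPairs H Ω → (p.1 + (g : Vd d) ∈ Ω ∨ p.2 + (g : Vd d) ∈ Ω) →
          p ∈ crossPairs H Ω := fun h h' => by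
        by_contra hc
        exact h ⟨⟨g, h'⟩, hc⟩
      simp only [hS₁, hS₂, hS₃, hS, hτ, pairsMeeting, Set.mem_union, Set.mem_inter_iff,
        Set.mem_preimage, Set.mem_ofPred_eq]
      tauto
    · rw [Set.disjoint_left]
      rintro p (⟨-, -, h1⟩ | ⟨-, h1, -⟩) ⟨-, h2, h3⟩
      · exact h1.2 h3
      · obtain ⟨a, b, hab, ha, hb⟩ := h3
        exact hab ((hdis _ _ _ ha h1).trans (hdis _ _ _ hb h2).symm)
    · rw [Set.disjoint_left]
      rintro p ⟨-, -, h1⟩ ⟨-, -, h3⟩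
      exact h1.2 h3
  have hd₁ : Pairwise (Function.onFun Disjoint S₁) := by
    intro a b hab
    rw [Function.onFun, Set.disjoint_left]
    rintro p ⟨-, h1, h2⟩ ⟨-, h3, -⟩
    rcases h1 with h1 | h1 <;> rcases h3 with h3 | h3
    · exact hab (hdis _ _ _ h1 h3)
    · exact h2.2 ⟨a, b, hab, h1, h3⟩
    · exact h2.2 ⟨b, a, hab.symm, h3, h1⟩
    · exact hab (hdis _ _ _ h1 h3)
  have hd₂ : Pairwise (Function.onFun Disjoint S₂) := by
    intro a b hab
    rw [Function.onFun, Set.disjoint_left]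
    rintro p ⟨-, h1, -⟩ ⟨-, h3, -⟩
    exact hab (hdis _ _ _ h1 h3)
  have hd₃ : Pairwise (Function.onFun Disjoint S₃) := by
    intro a b hab
    rw [Function.onFun, Set.disjoint_left]
    rintro p ⟨-, h1, -⟩ ⟨-, h3, -⟩
    exact hab (hdis _ _ _ h1 h3)
  have hlocal : ∀ (g : H) (p : Vd d × Vd d), p ∈ localPairs H Ω →
      (p.1 + (g : Vd d) ∈ Ω ∨ p.2 + (g : Vd d) ∈ Ω) →
      (p.1 ∈ F ↔ p.1 + (g : Vd d) ∈ B g) ∧ (p.2 ∈ F ↔ p.2 + (g : Vd d) ∈ B g) := by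
    intro g p hp h
    constructor
    · by_cases h1 : p.1 + (g : Vd d) ∈ Ω
      · exact hFB g _ h1
      · rw [hBE g _ h1]
        refine hFE _ fun k hk => hp.2 ⟨k, g, ?_, hk, h.resolve_left h1⟩
        rintro rfl
        exact h1 hk
    · by_cases h1 : p.2 + (g : Vd d) ∈ Ω
      · exact hFB g _ h1
      · rw [hBE g _ h1]
        refine hFE _ fun k hk => hp.2 ⟨g, k, ?_, h.resolve_right h1, hk⟩
        rintro rfl
        exact h1 hk
  simp only [hsplit]
  rw [ENNReal.tsum_add, ENNReal.tsum_add, ← measure_iUnion hd₁ hm₁, ← measure_iUnion hd₂ hm₂,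
    ← measure_iUnion hd₃ hm₃]
  congr 1
  · congr 1
    · congr 1
      ext p
      simp only [hS₁, hS, hτ, Set.mem_iUnion, Set.mem_inter_iff, Set.mem_preimage, Set.mem_prod,
        Set.mem_compl_iff, Set.mem_union, Set.mem_ofPred_eq]
      constructor
      · rintro ⟨g, ⟨h1, h2⟩, h3, h4⟩
        obtain ⟨h5, h6⟩ := hlocal g p h4 h3
        exact ⟨⟨h5.2 h1, fun h => h2 (h6.1 h)⟩, h4⟩
      · rintro ⟨⟨h1, h2⟩, h4⟩
        obtain ⟨g, h3⟩ := h4.1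
        obtain ⟨h5, h6⟩ := hlocal g p h4 h3
        exact ⟨g, ⟨h5.1 h1, fun h => h2 (h6.2 h)⟩, h3, h4⟩
    · congr 1
      ext p
      simp only [hS₂, hS, hτ, Set.mem_iUnion, Set.mem_inter_iff, Set.mem_preimage, Set.mem_prod,
        Set.mem_compl_iff, Set.mem_ofPred_eq]
      have hp2 : ∀ g : H, p.1 + (g : Vd d) ∈ Ω → p ∈ crossPairs H Ω →
          (p.2 + (g : Vd d) ∈ B g ↔ p.2 ∈ E) := by
        rintro g hg ⟨a, b, hab, ha, hb⟩
        refine hBE g _ fun h => hab ?_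
        rw [hdis _ _ _ ha hg, hdis _ _ _ hb h]
      constructor
      · rintro ⟨g, ⟨h1, h2⟩, h3, h4⟩
        exact ⟨⟨(hFB g _ h3).2 h1, fun h => h2 ((hp2 g h3 h4).2 h)⟩, h4⟩
      · rintro ⟨⟨h1, h2⟩, h4⟩
        obtain ⟨g, b, hab, h3, hb⟩ := id h4
        exact ⟨g, ⟨(hFB g _ h3).1 h1, fun h => h2 ((hp2 g h3 h4).1 h)⟩, h3, h4⟩
  · congr 1
    ext p
    simp only [hS₃, hS, hτ, Set.mem_iUnion, Set.mem_inter_iff, Set.mem_preimage, Set.mem_prod,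
      Set.mem_compl_iff, Set.mem_ofPred_eq]
    have hp1 : ∀ g : H, p.2 + (g : Vd d) ∈ Ω → p ∈ crossPairs H Ω →
        (p.1 + (g : Vd d) ∈ B g ↔ p.1 ∈ E) := by
      rintro g hg ⟨a, b, hab, ha, hb⟩
      refine hBE g _ fun h => hab ?_
      rw [hdis _ _ _ ha h, hdis _ _ _ hb hg]
    constructor
    · rintro ⟨g, ⟨h1, h2⟩, h3, h4⟩
      exact ⟨⟨(hp1 g h3 h4).1 h1, fun h => h2 ((hFB g _ h3).1 h)⟩, h4⟩
    · rintro ⟨⟨h1, h2⟩, h4⟩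
      obtain ⟨a, g, hab, ha, h3⟩ := id h4
      exact ⟨g, ⟨(hp1 g h3 h4).2 h1, fun h => h2 ((hFB g _ h3).2 h)⟩, h3, h4⟩

theorem kerMeasure_cross_le {K : Vd d → ℝ≥0∞} {E F : Set (Vd d)} {Q : Set (Vd d × Vd d)}
    (hE : MeasurableSet E) (hF : MeasurableSet F) (hQ : MeasurableSet Q) :
    kerMeasure K (E ×ˢ Eᶜ ∩ Q) + kerMeasure K (F ×ˢ Fᶜ ∩ Q) ≤
      kerMeasure K (F ×ˢ Eᶜ ∩ Q) + kerMeasure K (E ×ˢ Fᶜ ∩ Q) +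
        kerMeasure K ((E ∆ F) ×ˢ Set.univ ∩ Q) := by
  have h1 := (hE.prod hE.compl).inter hQ
  have h2 := (hF.prod hF.compl).inter hQ
  have h3 := (hF.prod hE.compl).inter hQ
  have h4 := (hE.prod hF.compl).inter hQ
  have h5 := ((hE.symmDiff hF).prod MeasurableSet.univ).inter hQ
  rw [← lintegral_indicator_one h1, ← lintegral_indicator_one h2, ← lintegral_indicator_one h3,
    ← lintegral_indicator_one h4, ← lintegral_indicator_one h5,
    ← lintegral_add_left (measurable_one.indicator h1),
    ← lintegral_add_left (measurable_one.indicator h3),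
    ← lintegral_add_right _ (measurable_one.indicator h5)]
  refine lintegral_mono fun p => ?_
  by_cases hq : p ∈ Q <;> by_cases a : p.1 ∈ E <;> by_cases b : p.1 ∈ F <;>
    by_cases c : p.2 ∈ E <;> by_cases e : p.2 ∈ F <;>
    simp [Set.indicator, Set.mem_symmDiff, hq, a, b, c, e]

theorem kerMeasure_far_le {K : Vd d → ℝ≥0∞} (hK : Measurable K) {S : Set (Vd d)}
    (hS : MeasurableSet S) {Q : Set (Vd d × Vd d)} {t : ℝ} (hQ : ∀ p ∈ Q, t ≤ dist p.1 p.2) :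
    kerMeasure K (S ×ˢ Set.univ ∩ Q) ≤ phiK K t * volume S := by
  set T : Set (Vd d) := (Metric.ball 0 t)ᶜ with hT
  have hTm : MeasurableSet T := measurableSet_ball.compl
  have hD : MeasurableSet {p : Vd d × Vd d | p.1 - p.2 ∈ T} :=
    (measurable_fst.sub measurable_snd) hTm
  have hSu : MeasurableSet (S ×ˢ (Set.univ : Set (Vd d))) := hS.prod .univ
  have hsub : S ×ˢ Set.univ ∩ Q ⊆ S ×ˢ Set.univ ∩ {p : Vd d × Vd d | p.1 - p.2 ∈ T} := by
    refine Set.inter_subset_inter_right _ fun p hp => ?_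
    have := hQ p hp
    simpa [hT, dist_eq_norm] using this
  have heq : kerMeasure K (S ×ˢ Set.univ ∩ {p : Vd d × Vd d | p.1 - p.2 ∈ T}) =
      kerMeasure (T.indicator K) (S ×ˢ Set.univ) := by
    rw [kerMeasure, kerMeasure, withDensity_apply _ (hSu.inter hD), withDensity_apply _ hSu,
      Set.inter_comm, ← setLIntegral_indicator hD]
    rfl
  refine (measure_mono hsub).trans (heq.trans ?_).le
  rw [kerMeasure_prod (hK.indicator hTm) hS .univ]
  simp only [Measure.restrict_univ, lintegral_sub_left_eq_self, lintegral_const,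
    lintegral_indicator hTm, Measure.restrict_apply_univ]
  rfl

theorem kerMeasure_split [Countable H] {K : Vd d → ℝ≥0∞} (hΩ : MeasurableSet Ω)
    {S : Set (Vd d × Vd d)} :
    kerMeasure K S = kerMeasure K (S \ (localPairs H Ω ∪ crossPairs H Ω)) +
      (kerMeasure K (S ∩ localPairs H Ω) + kerMeasure K (S ∩ crossPairs H Ω)) := by
  have hL := measurableSet_localPairs (H := H) hΩ
  have hC := measurableSet_crossPairs (H := H) hΩ
  rw [← measure_sdiff_add_inter S (hL.union hC)]
  congr 1
  rw [← measure_inter_add_sdiff (S ∩ (localPairs H Ω ∪ crossPairs H Ω)) hL]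
  congr 2 <;> ext p
  · simp only [Set.mem_inter_iff, Set.mem_union]
    tauto
  · have : p ∈ crossPairs H Ω → p ∉ localPairs H Ω := fun h h' => h'.2 h
    simp only [Set.mem_inter_iff, Set.mem_union, Set.mem_sdiff]
    tauto

theorem mem_setTranslate {g y : Vd d} {A : Set (Vd d)} :
    y + g ∈ setTranslate g A ↔ y ∈ A := by
  simp [setTranslate]

theorem setTranslate_eq_preimage (g : Vd d) (A : Set (Vd d)) :
    setTranslate g A = (fun x => x + -g) ⁻¹' A := by
  simp [setTranslate]

theorem measurableSet_setTranslate {A : Set (Vd d)} (hA : MeasurableSet A) (g : Vd d) :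
    MeasurableSet (setTranslate g A) := by
  rw [setTranslate_eq_preimage]
  exact (measurable_add_const _) hA

theorem volume_setTranslate (g : Vd d) (A : Set (Vd d)) :
    volume (setTranslate g A) = volume A := by
  rw [setTranslate_eq_preimage, measure_preimage_add_right]

theorem tsum_nlPerRel_translate_eq [Countable H] {K : Vd d → ℝ≥0∞} (hK : Measurable K)
    (hΩ : MeasurableSet Ω)
    (hdis : ∀ (g h : H) (y : Vd d), y + (g : Vd d) ∈ Ω → y + (h : Vd d) ∈ Ω → g = h)
    {E : Set (Vd d)} (hE : MeasurableSet E) :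
    ∑' g : H, nlPerRel K (setTranslate (g : Vd d) E) Ω =
      kerMeasure K (E ×ˢ Eᶜ ∩ localPairs H Ω) + kerMeasure K (E ×ˢ Eᶜ ∩ crossPairs H Ω) +
        kerMeasure K (E ×ˢ Eᶜ ∩ crossPairs H Ω) :=
  tsum_nlPerRel_eq (E := E) (F := E) hK hΩ hdis
    (fun g => measurableSet_setTranslate hE (g : Vd d))
    (fun _ _ _ => mem_setTranslate.symm) (fun _ _ => Iff.rfl) (fun _ _ _ => mem_setTranslate)

theorem sum_tsum_nlPerRel_translate_ne_top [Countable H] {K : Vd d → ℝ≥0∞} (hK : Measurable K)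
    (hΩ : MeasurableSet Ω)
    (hdis : ∀ (g h : H) (y : Vd d), y + (g : Vd d) ∈ Ω → y + (h : Vd d) ∈ Ω → g = h)
    {N : ℕ} {E : Fin N → Set (Vd d)} (hE : ∀ i, MeasurableSet (E i))
    (hfin : ∑ i, nlPer K (E i) ≠ ⊤) :
    ∑' p : Fin N × H, nlPerRel K (setTranslate (p.2 : Vd d) (E p.1)) Ω ≠ ⊤ := by
  rw [ENNReal.tsum_prod', tsum_fintype, ENNReal.sum_ne_top]
  intro i hi
  have := ENNReal.sum_ne_top.1 hfin i hi
  rw [nlPer_eq_kerMeasure hK (hE i)] at this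
  have hle : ∀ S, kerMeasure K (E i ×ˢ (E i)ᶜ ∩ S) ≠ ⊤ := fun S =>
    ne_top_of_le_ne_top this (measure_mono Set.inter_subset_left)
  rw [tsum_nlPerRel_translate_eq hK hΩ hdis (hE i)]
  simp [hle]

theorem sum_tsum_nlPerRel_translate_le [Countable H] {K : Vd d → ℝ≥0∞} (hK : Measurable K)
    (hΩ : MeasurableSet Ω)
    (hdis : ∀ (g h : H) (y : Vd d), y + (g : Vd d) ∈ Ω → y + (h : Vd d) ∈ Ω → g = h)
    {t : ℝ} (hfar : ∀ (g h : H) (x y : Vd d), g ≠ h → x + (g : Vd d) ∈ Ω → y + (h : Vd d) ∈ Ω →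
      t ≤ dist x y)
    {N : ℕ} {E F : Fin N → Set (Vd d)} {B : Fin N × H → Set (Vd d)}
    (hE : ∀ i, MeasurableSet (E i)) (hF : ∀ i, MeasurableSet (F i))
    (hB : ∀ p, MeasurableSet (B p))
    (hFB : ∀ i (g : H) (y : Vd d), y + (g : Vd d) ∈ Ω → (y ∈ F i ↔ y + (g : Vd d) ∈ B (i, g)))
    (hFE : ∀ i (y : Vd d), (∀ g : H, y + (g : Vd d) ∉ Ω) → (y ∈ F i ↔ y ∈ E i))
    (hBE : ∀ i (g : H) (y : Vd d), y + (g : Vd d) ∉ Ω → (y + (g : Vd d) ∈ B (i, g) ↔ y ∈ E i))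
    (hfin : ∑ i, nlPer K (E i) ≠ ⊤) (hle : ∑ i, nlPer K (E i) ≤ ∑ i, nlPer K (F i)) :
    ∑' p : Fin N × H, nlPerRel K (setTranslate (p.2 : Vd d) (E p.1)) Ω ≤
      ∑' p : Fin N × H, (nlPerRel K (B p) Ω +
        phiK K t * volume (setTranslate (p.2 : Vd d) (E p.1) ∆ B p)) := by
  set Lp := localPairs H Ω with hLp
  set Cp := crossPairs H Ω with hCp
  have hCm : MeasurableSet Cp := measurableSet_crossPairs hΩ
  have hvol : ∀ i, volume (E i ∆ F i) ≤
      ∑' g : H, volume (setTranslate (g : Vd d) (E i) ∆ B (i, g)) := by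
    intro i
    have hsub : E i ∆ F i ⊆ ⋃ g : H,
        (fun y => y + (g : Vd d)) ⁻¹' (setTranslate (g : Vd d) (E i) ∆ B (i, g)) := by
      intro y hy
      by_cases h : ∃ g : H, y + (g : Vd d) ∈ Ω
      · obtain ⟨g, hg⟩ := h
        refine Set.mem_iUnion.2 ⟨g, ?_⟩
        rw [Set.mem_preimage, Set.mem_symmDiff, mem_setTranslate, ← hFB i g y hg]
        exact hy
      · have := hFE i y fun g hg => h ⟨g, hg⟩
        rw [Set.mem_symmDiff, this] at hy
        tauto
    refine (measure_mono hsub).trans ((measure_iUnion_le _).trans_eq ?_)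
    simp only [measure_preimage_add_right]
  have hcross : ∀ i, kerMeasure K (E i ×ˢ (E i)ᶜ ∩ Cp) + kerMeasure K (F i ×ˢ (F i)ᶜ ∩ Cp) ≤
      kerMeasure K (F i ×ˢ (E i)ᶜ ∩ Cp) + kerMeasure K (E i ×ˢ (F i)ᶜ ∩ Cp) +
        phiK K t * ∑' g : H, volume (setTranslate (g : Vd d) (E i) ∆ B (i, g)) := by
    intro i
    refine (kerMeasure_cross_le (hE i) (hF i) hCm).trans ?_
    gcongr
    refine (kerMeasure_far_le hK ((hE i).symmDiff (hF i)) (t := t) ?_).trans ?_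
    · rintro p ⟨g, h, hgh, h1, h2⟩
      exact hfar g h _ _ hgh h1 h2
    · gcongr
      exact hvol i
  have hout : ∀ i, F i ×ˢ (F i)ᶜ \ (Lp ∪ Cp) = E i ×ˢ (E i)ᶜ \ (Lp ∪ Cp) := by
    intro i
    ext p
    rw [Set.mem_sdiff, Set.mem_sdiff]
    refine and_congr_left fun hp => ?_
    have hno : ∀ g : H, ¬ (p.1 + (g : Vd d) ∈ Ω ∨ p.2 + (g : Vd d) ∈ Ω) := by
      intro g hg
      by_cases hc : p ∈ Cp
      · exact hp (Or.inr hc)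
      · exact hp (Or.inl ⟨⟨g, hg⟩, hc⟩)
    rw [Set.mem_prod, Set.mem_prod, Set.mem_compl_iff, Set.mem_compl_iff,
      hFE i p.1 fun g hg => hno g (Or.inl hg), hFE i p.2 fun g hg => hno g (Or.inr hg)]
  simp only [nlPer_eq_kerMeasure hK (hE _)] at hfin hle
  simp only [nlPer_eq_kerMeasure hK (hF _)] at hle
  have hfin0 : ∑ i, kerMeasure K (E i ×ˢ (E i)ᶜ \ (Lp ∪ Cp)) ≠ ⊤ :=
    ne_top_of_le_ne_top hfin (Finset.sum_le_sum fun i _ => measure_mono Set.sdiff_subset)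
  have hle' : ∑ i, (kerMeasure K (E i ×ˢ (E i)ᶜ ∩ Lp) + kerMeasure K (E i ×ˢ (E i)ᶜ ∩ Cp)) ≤
      ∑ i, (kerMeasure K (F i ×ˢ (F i)ᶜ ∩ Lp) + kerMeasure K (F i ×ˢ (F i)ᶜ ∩ Cp)) := by
    rw [Finset.sum_congr rfl fun i _ => kerMeasure_split (H := H) hΩ (S := E i ×ˢ (E i)ᶜ),
      Finset.sum_congr rfl fun i _ => kerMeasure_split (H := H) hΩ (S := F i ×ˢ (F i)ᶜ)] at hle
    simp only [← hLp, ← hCp, hout] at hle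
    simp only [Finset.sum_add_distrib] at hle ⊢
    exact (ENNReal.add_le_add_iff_left hfin0).1 hle
  rw [ENNReal.tsum_prod', tsum_fintype, ENNReal.tsum_prod', tsum_fintype]
  simp only [ENNReal.tsum_add, ENNReal.tsum_mul_left,
    tsum_nlPerRel_translate_eq hK hΩ hdis (hE _),
    tsum_nlPerRel_eq hK hΩ hdis (fun g => hB (_, g)) (hFB _) (hFE _) (hBE _)]
  calc ∑ i, (kerMeasure K (E i ×ˢ (E i)ᶜ ∩ Lp) + kerMeasure K (E i ×ˢ (E i)ᶜ ∩ Cp) +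
          kerMeasure K (E i ×ˢ (E i)ᶜ ∩ Cp))
      ≤ ∑ i, (kerMeasure K (F i ×ˢ (F i)ᶜ ∩ Lp) + kerMeasure K (F i ×ˢ (F i)ᶜ ∩ Cp)) +
          ∑ i, kerMeasure K (E i ×ˢ (E i)ᶜ ∩ Cp) := by
        rw [Finset.sum_add_distrib]
        gcongr
    _ = ∑ i, (kerMeasure K (F i ×ˢ (F i)ᶜ ∩ Lp) + (kerMeasure K (E i ×ˢ (E i)ᶜ ∩ Cp) +
          kerMeasure K (F i ×ˢ (F i)ᶜ ∩ Cp))) := by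
        rw [← Finset.sum_add_distrib]
        exact Finset.sum_congr rfl fun i _ => by ring
    _ ≤ _ := by
        refine Finset.sum_le_sum fun i _ => ?_
        simp only [add_assoc] at hcross ⊢
        exact add_le_add le_rfl (hcross i)

variable (H Ω) in
/-- The set `E`, replaced by `B g - g` inside `Ω - g` for every `g`. -/
def periodize (E : Set (Vd d)) (B : H → Set (Vd d)) : Set (Vd d) :=
  {y | (y ∈ E ∧ ∀ g : H, y + (g : Vd d) ∉ Ω) ∨
    ∃ g : H, y + (g : Vd d) ∈ Ω ∧ y + (g : Vd d) ∈ B g}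

theorem mem_periodize_of_mem
    (hdis : ∀ (g h : H) (y : Vd d), y + (g : Vd d) ∈ Ω → y + (h : Vd d) ∈ Ω → g = h)
    {E : Set (Vd d)} {B : H → Set (Vd d)} {g : H} {y : Vd d} (hy : y + (g : Vd d) ∈ Ω) :
    y ∈ periodize H Ω E B ↔ y + (g : Vd d) ∈ B g := by
  constructor
  · rintro (⟨-, h⟩ | ⟨h, h1, h2⟩)
    · exact absurd hy (h g)
    · rwa [hdis g h y hy h1]
  · exact fun h => Or.inr ⟨g, hy, h⟩

theorem mem_periodize_of_notMem {E : Set (Vd d)} {B : H → Set (Vd d)} {y : Vd d}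
    (hy : ∀ g : H, y + (g : Vd d) ∉ Ω) : y ∈ periodize H Ω E B ↔ y ∈ E := by
  constructor
  · rintro (⟨h, -⟩ | ⟨h, h1, -⟩)
    · exact h
    · exact absurd h1 (hy h)
  · exact fun h => Or.inl ⟨h, hy⟩

theorem measurableSet_periodize [Countable H] (hΩ : MeasurableSet Ω) {E : Set (Vd d)}
    {B : H → Set (Vd d)} (hE : MeasurableSet E) (hB : ∀ g, MeasurableSet (B g)) :
    MeasurableSet (periodize H Ω E B) := by
  have heq : periodize H Ω E B = (E ∩ ⋂ g : H, (fun y => y + (g : Vd d)) ⁻¹' Ωᶜ) ∪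
      ⋃ g : H, (fun y => y + (g : Vd d)) ⁻¹' (Ω ∩ B g) := by
    ext y
    simp [periodize]
  rw [heq]
  exact (hE.inter (.iInter fun g => (measurable_add_const _) hΩ.compl)).union
    (.iUnion fun g => (measurable_add_const _) (hΩ.inter (hB g)))

theorem volume_eq_tsum_translates [Countable H] (hΩ : MeasurableSet Ω)
    (hdis : ∀ (g h : H) (y : Vd d), y + (g : Vd d) ∈ Ω → y + (h : Vd d) ∈ Ω → g = h)
    {S : Set (Vd d)} :
    volume S = volume (S \ ⋃ g : H, (fun y => y + (g : Vd d)) ⁻¹' Ω) +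
      ∑' g : H, volume (setTranslate (g : Vd d) S ∩ Ω) := by
  have hm : ∀ g : H, MeasurableSet ((fun y => y + (g : Vd d)) ⁻¹' Ω) := fun g =>
    (measurable_add_const _) hΩ
  have hd : Pairwise (Function.onFun Disjoint
      fun g : H => (fun y => y + (g : Vd d)) ⁻¹' Ω) := by
    intro g h hgh
    exact Set.disjoint_left.2 fun y h1 h2 => hgh (hdis _ _ y h1 h2)
  rw [← measure_sdiff_add_inter S (MeasurableSet.iUnion hm)]
  congr 1
  rw [Set.inter_comm, ← Measure.restrict_apply (.iUnion hm), measure_iUnion hd hm]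
  refine tsum_congr fun g => ?_
  rw [Measure.restrict_apply (hm g),
    ← measure_preimage_add_right volume (g : Vd d) (setTranslate (g : Vd d) S ∩ Ω)]
  congr 1
  ext y
  rw [Set.mem_preimage, Set.mem_inter_iff, Set.mem_inter_iff, mem_setTranslate, and_comm]
  rfl

theorem volume_periodize [Countable H] (hΩ : MeasurableSet Ω)
    (hdis : ∀ (g h : H) (y : Vd d), y + (g : Vd d) ∈ Ω → y + (h : Vd d) ∈ Ω → g = h)
    {E : Set (Vd d)} {B : H → Set (Vd d)}
    (hvol : ∀ g : H, volume (setTranslate (g : Vd d) E ∩ Ω) = volume (B g ∩ Ω)) :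
    volume (periodize H Ω E B) = volume E := by
  rw [volume_eq_tsum_translates hΩ hdis, volume_eq_tsum_translates hΩ hdis (S := E)]
  congr 1
  · congr 1
    ext y
    rw [Set.mem_sdiff, Set.mem_sdiff]
    refine and_congr_left fun hy => mem_periodize_of_notMem fun g hg => hy ?_
    exact Set.mem_iUnion.2 ⟨g, hg⟩
  · refine tsum_congr fun g => ?_
    rw [hvol]
    congr 1
    ext z
    refine and_congr_left fun hz => ?_
    obtain ⟨y, rfl⟩ : ∃ y, y + (g : Vd d) = z := ⟨z - g, sub_add_cancel _ _⟩
    rw [mem_setTranslate, mem_periodize_of_mem hdis hz]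

theorem isPartition_translates [Countable H] {N : ℕ} {v : Fin N → ℝ} {D : Set (Vd d)}
    {E : Fin N → Set (Vd d)} (hD : IsFundDom (H : Set (Vd d)) D) (hE : AdmissiblePart D v E) :
    IsPartition fun p : Fin N × H => setTranslate (p.2 : Vd d) (E p.1) := by
  obtain ⟨-, hD1, hD2⟩ := hD
  obtain ⟨hEm, hED, -, hE1, hE2⟩ := hE
  refine ⟨fun p => measurableSet_setTranslate (hEm _) _, ?_, ?_⟩
  · rintro ⟨i, g⟩ ⟨j, h⟩ hne
    by_cases hgh : g = h
    · subst hgh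
      have hij : i ≠ j := fun hij => hne (by rw [hij])
      rw [← hE1 i j hij, ← measure_preimage_add_right volume (g : Vd d)]
      congr 1
      ext y
      simp only [Set.mem_preimage, Set.mem_inter_iff, mem_setTranslate]
    · have hne' : (g - h : Vd d) ≠ 0 := fun h0 => hgh (Subtype.ext (sub_eq_zero.1 h0))
      have h0 := hD1 (g - h : Vd d) (H.sub_mem g.2 h.2) hne'
      rw [← measure_preimage_add_right volume (h : Vd d)]
      refine measure_mono_null ?_ h0
      rintro y ⟨h1, h2⟩
      refine ⟨?_, hED j (mem_setTranslate.1 h2)⟩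
      obtain ⟨z, hz⟩ : ∃ z, z + (g - h : Vd d) = y := ⟨y - (g - h), sub_add_cancel _ _⟩
      rw [← hz] at h1 ⊢
      change z + (g - h : Vd d) + h ∈ setTranslate (g : Vd d) (E i) at h1
      rw [add_assoc, sub_add_cancel, mem_setTranslate] at h1
      exact mem_setTranslate.2 (hED i h1)
  · have hsub : (Set.univ \ ⋃ p : Fin N × H, setTranslate (p.2 : Vd d) (E p.1)) ⊆
        (Set.univ \ ⋃ g ∈ (H : Set (Vd d)), setTranslate g D) ∪
          ⋃ g : H, setTranslate (g : Vd d) (D \ ⋃ i, E i) := by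
      rintro z ⟨-, hz⟩
      by_cases h : z ∈ ⋃ g ∈ (H : Set (Vd d)), setTranslate g D
      · right
        obtain ⟨g, hg, hzg⟩ := Set.mem_iUnion₂.1 h
        refine Set.mem_iUnion.2 ⟨⟨g, hg⟩, ?_⟩
        obtain ⟨y, rfl⟩ : ∃ y, y + g = z := ⟨z - g, sub_add_cancel _ _⟩
        rw [mem_setTranslate] at hzg ⊢
        refine ⟨hzg, fun hy => hz ?_⟩
        obtain ⟨i, hi⟩ := Set.mem_iUnion.1 hy
        exact Set.mem_iUnion.2 ⟨(i, ⟨g, hg⟩), mem_setTranslate.2 hi⟩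
      · exact Or.inl ⟨trivial, h⟩
    refine measure_mono_null hsub (measure_union_null hD2 (measure_iUnion_null fun g => ?_))
    rw [volume_setTranslate, hE2]

theorem isFundDom_iUnion_of_isPartition {N : ℕ} {F : Fin N → Set (Vd d)}
    (hF : ∀ i, MeasurableSet (F i))
    (hP : IsPartition fun p : Fin N × H => setTranslate (p.2 : Vd d) (F p.1)) :
    IsFundDom (H : Set (Vd d)) (⋃ i, F i) ∧ ∀ i j, i ≠ j → volume (F i ∩ F j) = 0 := by
  obtain ⟨-, hP1, hP2⟩ := hP
  have htr0 : ∀ A : Set (Vd d), setTranslate 0 A = A := fun A => by simp [setTranslate]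
  refine ⟨⟨.iUnion hF, fun g hg hg0 => ?_, ?_⟩, fun i j hij => ?_⟩
  · have hsub : setTranslate g (⋃ i, F i) ∩ (⋃ i, F i) ⊆
        ⋃ (i : Fin N) (j : Fin N), (setTranslate g (F i) ∩ setTranslate 0 (F j)) := by
      rintro z ⟨h1, h2⟩
      obtain ⟨y, rfl⟩ : ∃ y, y + g = z := ⟨z - g, sub_add_cancel _ _⟩
      rw [mem_setTranslate] at h1
      obtain ⟨i, hi⟩ := Set.mem_iUnion.1 h1
      obtain ⟨j, hj⟩ := Set.mem_iUnion.1 h2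
      exact Set.mem_iUnion₂.2 ⟨i, j, mem_setTranslate.2 hi, by rwa [htr0]⟩
    refine measure_mono_null hsub (measure_iUnion_null fun i => measure_iUnion_null fun j => ?_)
    refine hP1 (i, ⟨g, hg⟩) (j, 0) fun h => hg0 ?_
    exact congrArg Subtype.val (Prod.ext_iff.1 h).2
  · refine measure_mono_null ?_ hP2
    refine Set.sdiff_subset_sdiff_right (Set.iUnion_subset fun p => ?_)
    refine Set.subset_iUnion₂_of_subset (p.2 : Vd d) p.2.2 ?_
    exact Set.image_mono (Set.subset_iUnion _ _)
  · have := hP1 (i, 0) (j, 0) fun h => hij (Prod.ext_iff.1 h).1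
    simpa [htr0] using this

theorem isPartition_periodize [Countable H] (hΩ : MeasurableSet Ω)
    (hdis : ∀ (g h : H) (y : Vd d), y + (g : Vd d) ∈ Ω → y + (h : Vd d) ∈ Ω → g = h)
    {N : ℕ} {E : Fin N → Set (Vd d)} {B : Fin N × H → Set (Vd d)}
    (hE : ∀ i, MeasurableSet (E i)) (hB : IsPartition B)
    (hA : IsPartition fun p : Fin N × H => setTranslate (p.2 : Vd d) (E p.1)) :
    IsPartition fun p : Fin N × H =>
      setTranslate (p.2 : Vd d) (periodize H Ω (E p.1) fun g => B (p.1, g)) := by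
  obtain ⟨-, hA1, hA2⟩ := hA
  obtain ⟨hBm, hB1, hB2⟩ := hB
  have hin : ∀ (i : Fin N) (g h : H) (z : Vd d), z + (h : Vd d) ∈ Ω →
      (z ∈ setTranslate (g : Vd d) (periodize H Ω (E i) fun g => B (i, g)) ↔
        z + (h : Vd d) ∈ B (i, g + h)) := by
    intro i g h z hz
    obtain ⟨y, rfl⟩ : ∃ y, y + (g : Vd d) = z := ⟨z - g, sub_add_cancel _ _⟩
    rw [add_assoc] at hz ⊢
    rw [mem_setTranslate]
    exact mem_periodize_of_mem hdis (g := g + h) hz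
  have hout : ∀ (i : Fin N) (g : H) (z : Vd d), (∀ h : H, z + (h : Vd d) ∉ Ω) →
      (z ∈ setTranslate (g : Vd d) (periodize H Ω (E i) fun g => B (i, g)) ↔
        z ∈ setTranslate (g : Vd d) (E i)) := by
    intro i g z hz
    obtain ⟨y, rfl⟩ : ∃ y, y + (g : Vd d) = z := ⟨z - g, sub_add_cancel _ _⟩
    rw [mem_setTranslate, mem_setTranslate]
    refine mem_periodize_of_notMem fun h hh => hz (h - g) ?_
    simpa [add_assoc] using hh
  refine ⟨fun p => measurableSet_setTranslate
    (measurableSet_periodize hΩ (hE _) fun g => hBm _) _, ?_, ?_⟩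
  · rintro ⟨i, g⟩ ⟨j, k⟩ hne
    have hsub : setTranslate (g : Vd d) (periodize H Ω (E i) fun g => B (i, g)) ∩
        setTranslate (k : Vd d) (periodize H Ω (E j) fun g => B (j, g)) ⊆
        (setTranslate (g : Vd d) (E i) ∩ setTranslate (k : Vd d) (E j)) ∪
          ⋃ h : H, (fun z => z + (h : Vd d)) ⁻¹' (B (i, g + h) ∩ B (j, k + h)) := by
      rintro z ⟨h1, h2⟩
      by_cases hz : ∃ h : H, z + (h : Vd d) ∈ Ω
      · obtain ⟨h, hh⟩ := hz
        exact Or.inr (Set.mem_iUnion.2 ⟨h, (hin i g h z hh).1 h1, (hin j k h z hh).1 h2⟩)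
      · push Not at hz
        exact Or.inl ⟨(hout i g z hz).1 h1, (hout j k z hz).1 h2⟩
    refine measure_mono_null hsub (measure_union_null (hA1 _ _ hne)
      (measure_iUnion_null fun h => ?_))
    rw [measure_preimage_add_right]
    refine hB1 _ _ fun heq => hne ?_
    obtain ⟨h1, h2⟩ := Prod.ext_iff.1 heq
    exact Prod.ext h1 (add_right_cancel h2)
  · have hsub : (Set.univ \ ⋃ p : Fin N × H,
        setTranslate (p.2 : Vd d) (periodize H Ω (E p.1) fun g => B (p.1, g))) ⊆
        (Set.univ \ ⋃ p : Fin N × H, setTranslate (p.2 : Vd d) (E p.1)) ∪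
          ⋃ h : H, (fun z => z + (h : Vd d)) ⁻¹' (Set.univ \ ⋃ p, B p) := by
      rintro z ⟨-, hz⟩
      by_cases hz' : ∃ h : H, z + (h : Vd d) ∈ Ω
      · obtain ⟨h, hh⟩ := hz'
        refine Or.inr (Set.mem_iUnion.2 ⟨h, trivial, fun hzB => hz ?_⟩)
        obtain ⟨⟨i, k⟩, hik⟩ := Set.mem_iUnion.1 hzB
        refine Set.mem_iUnion.2 ⟨(i, k - h), (hin i (k - h) h z hh).2 ?_⟩
        rwa [sub_add_cancel]
      · push Not at hz'
        refine Or.inl ⟨trivial, fun hzA => hz ?_⟩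
        obtain ⟨⟨i, k⟩, hik⟩ := Set.mem_iUnion.1 hzA
        exact Set.mem_iUnion.2 ⟨(i, k), (hout i k z hz').2 hik⟩
    refine measure_mono_null hsub (measure_union_null hA2 (measure_iUnion_null fun h => ?_))
    rw [measure_preimage_add_right, hB2]

end Periodic

theorem exists_addSubgroup_of_latticeOf (b : Fin d → Vd d) :
    ∃ H : AddSubgroup (Vd d), (H : Set (Vd d)) = latticeOf b ∧ Countable H := by
  let f : (Fin d → ℤ) →+ Vd d :=
    { toFun := fun k => ∑ i, (k i : ℝ) • b i
      map_zero' := by simp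
      map_add' := fun k l => by simp [add_smul, Finset.sum_add_distrib] }
  refine ⟨f.range, ?_, ?_⟩
  · ext x
    exact ⟨fun ⟨k, hk⟩ => ⟨k, hk.symm⟩, fun ⟨k, hk⟩ => ⟨k, hk.symm⟩⟩
  · exact (Set.countable_range f).to_subtype

theorem packingRadius_le_dist {G : Set (Vd d)} {g h : Vd d} (hg : g ∈ G) (hh : h ∈ G)
    (hgh : g ≠ h) : packingRadius G ≤ dist g h := by
  refine Real.sSup_le ?_ dist_nonneg
  rintro r ⟨hr, hr'⟩
  by_contra! hlt
  exact Set.disjoint_left.1 (hr' g hg h hh hgh) (Metric.mem_ball'.2 hlt)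
    (Metric.mem_ball_self hr)

theorem nlPer_eq_lintegral_translate {K : Vd d → ℝ≥0∞} (hK : Measurable K) {E : Set (Vd d)}
    (hE : MeasurableSet E) :
    nlPer K E = ∫⁻ z, K z * volume (E ∩ {x | x - z ∉ E}) := by
  have hdiff : MeasurableSet {p : Vd d × Vd d | p.1 - p.2 ∈ Eᶜ} :=
    (measurable_fst.sub measurable_snd) hE.compl
  have hm : Measurable fun p : Vd d × Vd d => Eᶜ.indicator (fun _ => K p.2) (p.1 - p.2) :=
    (hK.comp measurable_snd).indicator hdiff
  calc nlPer K E = ∫⁻ x in E, ∫⁻ z, Eᶜ.indicator (fun _ => K z) (x - z) := by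
        refine lintegral_congr fun x => ?_
        rw [← lintegral_indicator hE.compl,
          ← lintegral_sub_left_eq_self (fun y => Eᶜ.indicator (fun y => K (x - y)) y) x]
        refine lintegral_congr fun z => ?_
        simp [Set.indicator]
    _ = ∫⁻ z, ∫⁻ x in E, Eᶜ.indicator (fun _ => K z) (x - z) :=
        lintegral_lintegral_swap hm.aemeasurable
    _ = _ := by
        refine lintegral_congr fun z => ?_
        have hz : MeasurableSet {x | x - z ∉ E} := (measurable_id.sub_const z) hE.compl
        have : (fun x => Eᶜ.indicator (fun _ => K z) (x - z)) =
            {x | x - z ∉ E}.indicator fun _ => K z := by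
          ext x
          by_cases h : x - z ∈ E <;> simp [h]
        rw [this, lintegral_indicator_const hz, Measure.restrict_apply hz, Set.inter_comm]

theorem volume_box (a b : Fin d → ℝ) :
    volume {x : Vd d | ∀ j, x j ∈ Set.Ico (a j) (b j)} = ∏ j, ENNReal.ofReal (b j - a j) := by
  have hm : MeasurableSet (Set.univ.pi fun j => Set.Ico (a j) (b j)) :=
    .univ_pi fun _ => measurableSet_Ico
  have h := (PiLp.volume_preserving_ofLp (Fin d)).measure_preimage hm.nullMeasurableSet
  rw [← Real.volume_pi_Ico, ← h]
  congr 1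
  ext x
  simp [Set.mem_pi]

theorem measurableSet_box (a b : Fin d → ℝ) :
    MeasurableSet {x : Vd d | ∀ j, x j ∈ Set.Ico (a j) (b j)} := by
  have heq : {x : Vd d | ∀ j, x j ∈ Set.Ico (a j) (b j)} =
      ⋂ j, (fun x : Vd d => x j) ⁻¹' Set.Ico (a j) (b j) := by
    ext x
    simp
  rw [heq]
  exact .iInter fun j => (EuclideanSpace.proj (𝕜 := ℝ) j).continuous.measurable measurableSet_Ico

theorem volume_box_sdiff_translate_le (a b : Fin d → ℝ) (z : Vd d) :
    volume ({x : Vd d | ∀ j, x j ∈ Set.Ico (a j) (b j)} ∩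
        {x | x - z ∉ {x : Vd d | ∀ j, x j ∈ Set.Ico (a j) (b j)}}) ≤
      (∑ j, 2 * ∏ k ∈ Finset.univ.erase j, ENNReal.ofReal (b k - a k)) * ENNReal.ofReal ‖z‖ := by
  have hslab : ∀ (j : Fin d) (c : ℝ),
      volume {x : Vd d | ∀ k, x k ∈ Set.Ico (Function.update a j c k)
        (Function.update b j (c + ‖z‖) k)} =
      (∏ k ∈ Finset.univ.erase j, ENNReal.ofReal (b k - a k)) * ENNReal.ofReal ‖z‖ := by
    intro j c
    rw [volume_box, ← Finset.mul_prod_erase _ _ (Finset.mem_univ j), mul_comm]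
    simp only [Function.update_self, add_sub_cancel_left]
    congr 1
    refine Finset.prod_congr rfl fun k hk => ?_
    have := Finset.ne_of_mem_erase hk
    simp [this]
  have hsub : {x : Vd d | ∀ j, x j ∈ Set.Ico (a j) (b j)} ∩
        {x | x - z ∉ {x : Vd d | ∀ j, x j ∈ Set.Ico (a j) (b j)}} ⊆
      ⋃ j, ({x : Vd d | ∀ k, x k ∈ Set.Ico (Function.update a j (a j) k)
          (Function.update b j (a j + ‖z‖) k)} ∪
        {x : Vd d | ∀ k, x k ∈ Set.Ico (Function.update a j (b j - ‖z‖) k)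
          (Function.update b j (b j - ‖z‖ + ‖z‖) k)}) := by
    rintro x ⟨hx, hxz⟩
    simp only [Set.mem_ofPred_eq, not_forall] at hx hxz
    obtain ⟨j, hj⟩ := hxz
    have hzj : |z j| ≤ ‖z‖ := PiLp.norm_apply_le z j
    obtain ⟨hz1, hz2⟩ := abs_le.1 hzj
    refine Set.mem_iUnion.2 ⟨j, ?_⟩
    have hxj := hx j
    rw [Set.mem_Ico] at hj hxj
    rw [PiLp.sub_apply] at hj
    have aux : ∀ c, x j ∈ Set.Ico c (c + ‖z‖) → ∀ k,
        x k ∈ Set.Ico (Function.update a j c k) (Function.update b j (c + ‖z‖) k) := by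
      intro c hc k
      by_cases hk : k = j
      · subst hk
        simpa using hc
      · simpa [hk] using hx k
    by_cases h1 : a j ≤ x j - z j
    · refine Or.inr (aux _ ⟨?_, ?_⟩)
      · have : b j ≤ x j - z j := by
          by_contra! h2
          exact hj ⟨h1, h2⟩
        linarith
      · linarith [hxj.2]
    · exact Or.inl (aux _ ⟨hxj.1, by linarith⟩)
  refine (measure_mono hsub).trans ((measure_iUnion_fintype_le _ _).trans ?_)
  rw [Finset.sum_mul]
  refine Finset.sum_le_sum fun j _ => (measure_union_le _ _).trans_eq ?_
  rw [hslab, hslab]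
  ring

theorem nlPer_box_lt_top {K : Vd d → ℝ≥0∞} (hK : IsKernelBase K) (a b : Fin d → ℝ) :
    nlPer K {x : Vd d | ∀ j, x j ∈ Set.Ico (a j) (b j)} < ⊤ := by
  obtain ⟨hKm, -, hKi⟩ := hK
  rw [nlPer_eq_lintegral_translate hKm (measurableSet_box a b)]
  set M₁ : ℝ≥0∞ := ∑ j, 2 * ∏ k ∈ Finset.univ.erase j, ENNReal.ofReal (b k - a k)
  set M₂ : ℝ≥0∞ := ∏ j, ENNReal.ofReal (b j - a j)
  have hM₁t : M₁ ≠ ⊤ := ENNReal.sum_ne_top.2 fun j _ =>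
    ENNReal.mul_ne_top (by simp) (ENNReal.prod_ne_top fun k _ => ENNReal.ofReal_ne_top)
  have hM₂t : M₂ ≠ ⊤ := ENNReal.prod_ne_top fun k _ => ENNReal.ofReal_ne_top
  have hbound : ∀ z : Vd d, K z * volume ({x : Vd d | ∀ j, x j ∈ Set.Ico (a j) (b j)} ∩
        {x | x - z ∉ {x : Vd d | ∀ j, x j ∈ Set.Ico (a j) (b j)}}) ≤
      (M₁ + M₂) * (ENNReal.ofReal (min 1 ‖z‖) * K z) := by
    intro z
    rw [mul_comm (K z), ← mul_assoc]
    gcongr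
    rcases le_total 1 ‖z‖ with h | h
    · rw [min_eq_left h, ENNReal.ofReal_one, mul_one]
      refine (measure_mono Set.inter_subset_left).trans ?_
      rw [volume_box]
      exact le_add_self
    · rw [min_eq_right h]
      refine (volume_box_sdiff_translate_le a b z).trans ?_
      gcongr
      exact le_self_add
  refine (lintegral_mono hbound).trans_lt ?_
  rw [lintegral_const_mul' _ _ (ENNReal.add_ne_top.2 ⟨hM₁t, hM₂t⟩)]
  exact ENNReal.mul_lt_top (ENNReal.add_lt_top.2 ⟨hM₁t.lt_top, hM₂t.lt_top⟩) hKi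

theorem isLatticeWithVol_cubic {L : ℝ} (hL : 0 < L) :
    IsLatticeWithVol {x : Vd d | ∀ j, ∃ k : ℤ, x j = k * L} (L ^ d) := by
  refine ⟨fun i => L • EuclideanSpace.single i 1, ?_, ?_, ?_⟩
  · have h := (EuclideanSpace.basisFun (Fin d) ℝ).orthonormal.linearIndependent
    have heq : (fun i => L • EuclideanSpace.single i 1 : Fin d → Vd d) =
        (fun _ : Fin d => Units.mk0 L hL.ne') • ⇑(EuclideanSpace.basisFun (Fin d) ℝ) := by
      ext i
      simp [Units.smul_def]
    rw [heq]
    exact h.units_smul _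
  · ext x
    have hcoord : ∀ (k : Fin d → ℤ) (j : Fin d),
        (∑ i, (k i : ℝ) • L • EuclideanSpace.single i (1 : ℝ) : Vd d) j = k j * L := by
      intro k j
      simp [Finset.sum_apply, Pi.single_apply]
    constructor
    · intro hx
      choose k hk using hx
      exact ⟨k, by ext j; rw [hcoord, hk]⟩
    · rintro ⟨k, rfl⟩ j
      exact ⟨k j, hcoord k j⟩
  · have : (Matrix.of fun i j : Fin d => (L • EuclideanSpace.single j (1 : ℝ) : Vd d) i) =
        Matrix.diagonal fun _ => L := by
      ext i j
      simp [Matrix.diagonal_apply]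
    rw [this, Matrix.det_diagonal]
    simp [abs_of_pos hL]

theorem isFundDom_cube {L : ℝ} (hL : 0 < L) :
    IsFundDom {x : Vd d | ∀ j, ∃ k : ℤ, x j = k * L} {x | ∀ j, x j ∈ Set.Ico 0 L} := by
  refine ⟨measurableSet_box (fun _ => 0) fun _ => L, fun g hg hg0 => ?_, ?_⟩
  · have hempty : setTranslate g {x : Vd d | ∀ j, x j ∈ Set.Ico 0 L} ∩
        {x | ∀ j, x j ∈ Set.Ico 0 L} = ∅ := by
      refine Set.eq_empty_iff_forall_notMem.2 ?_
      rintro _ ⟨⟨y, hy, rfl⟩, hyg⟩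
      refine hg0 ?_
      ext j
      obtain ⟨k, hk⟩ := hg j
      have h1 := hy j
      have h2 := hyg j
      simp only [PiLp.add_apply, hk, Set.mem_Ico] at h1 h2
      have h3 : (k : ℝ) < 1 := by
        by_contra! h
        nlinarith
      have h4 : (-1 : ℝ) < k := by
        by_contra! h
        nlinarith
      have h5 : k = 0 := by
        have h3' : k < 1 := by exact_mod_cast h3
        have h4' : -1 < k := by exact_mod_cast h4
        omega
      simp [hk, h5]
    rw [hempty, measure_empty]
  · have huniv : (⋃ g ∈ {x : Vd d | ∀ j, ∃ k : ℤ, x j = k * L},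
        setTranslate g {x : Vd d | ∀ j, x j ∈ Set.Ico 0 L}) = Set.univ := by
      refine Set.eq_univ_of_forall fun y => ?_
      refine Set.mem_iUnion₂.2 ⟨WithLp.toLp 2 fun j => (⌊y j / L⌋ : ℝ) * L,
        fun j => ⟨⌊y j / L⌋, rfl⟩, y - WithLp.toLp 2 fun j => (⌊y j / L⌋ : ℝ) * L, ?_,
        sub_add_cancel _ _⟩
      intro j
      have h1 := (le_div_iff₀ hL).1 (Int.floor_le (y j / L))
      have h2 := (div_lt_iff₀ hL).1 (Int.lt_floor_add_one (y j / L))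
      simp only [PiLp.sub_apply, Set.mem_Ico]
      constructor <;> linarith
    rw [huniv, Set.sdiff_self, measure_empty]

theorem exists_admissible_nlPer_ne_top (hd : 1 ≤ d) {K : Vd d → ℝ≥0∞} (hK : IsKernelBase K)
    {L : ℝ} (hL : 0 < L) {N : ℕ} {v : Fin N → ℝ} (hv : ∀ i, 0 < v i)
    (hsum : ∑ i, v i = L ^ d) :
    ∃ (G D : Set (Vd d)) (E : Fin N → Set (Vd d)), IsLatticeWithVol G (L ^ d) ∧
      IsFundDom G D ∧ AdmissiblePart D v E ∧ ∑ i, nlPer K (E i) ≠ ⊤ := by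
  set j₀ : Fin d := ⟨0, hd⟩
  set w : ℕ → ℝ := fun n => if h : n < N then v ⟨n, h⟩ / L ^ (d - 1) else 0 with hw
  have hw0 : ∀ n, 0 ≤ w n := by
    intro n
    simp only [hw]
    split_ifs
    · exact div_nonneg (hv _).le (by positivity)
    · exact le_rfl
  have hwi : ∀ i : Fin N, w i = v i / L ^ (d - 1) := fun i => by simp [hw]
  set c : ℕ → ℝ := fun n => ∑ k ∈ Finset.range n, w k with hc
  have hcs : ∀ n, c (n + 1) = c n + w n := fun n => Finset.sum_range_succ _ _
  have hcm : Monotone c := monotone_nat_of_le_succ fun n => by rw [hcs]; linarith [hw0 n]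
  have hc0 : c 0 = 0 := by simp [hc]
  have hLd : L ^ d = L ^ (d - 1) * L := by rw [← pow_succ, Nat.sub_add_cancel hd]
  have hcN : c N = L := by
    simp only [hc]
    rw [← Fin.sum_univ_eq_sum_range, Finset.sum_congr rfl fun i _ => hwi i, ← Finset.sum_div,
      hsum, hLd]
    field_simp
  set a : Fin N → Fin d → ℝ := fun i => Function.update (fun _ => 0) j₀ (c i) with ha
  set b : Fin N → Fin d → ℝ := fun i => Function.update (fun _ => L) j₀ (c (i + 1)) with hb
  set D : Set (Vd d) := {x | ∀ j, x j ∈ Set.Ico 0 L}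
  set E : Fin N → Set (Vd d) := fun i => {x | ∀ j, x j ∈ Set.Ico (a i j) (b i j)} with hE
  have hmem : ∀ i x, x ∈ E i ↔ x j₀ ∈ Set.Ico (c i) (c (i + 1)) ∧
      ∀ j, j ≠ j₀ → x j ∈ Set.Ico 0 L := by
    intro i x
    constructor
    · intro hx
      refine ⟨by simpa [ha, hb] using hx j₀, fun j hj => by simpa [ha, hb, hj] using hx j⟩
    · rintro ⟨h1, h2⟩ j
      by_cases hj : j = j₀
      · subst hj
        simpa [ha, hb] using h1
      · simpa [ha, hb, hj] using h2 j hj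
  refine ⟨_, D, E, isLatticeWithVol_cubic hL, isFundDom_cube hL, ⟨?_, ?_, ?_, ?_, ?_⟩, ?_⟩
  · exact fun i => measurableSet_box _ _
  · intro i x hx j
    obtain ⟨h1, h2⟩ := (hmem i x).1 hx
    by_cases hj : j = j₀
    · subst hj
      refine ⟨?_, ?_⟩
      · rw [← hc0]
        exact (hcm (Nat.zero_le _)).trans h1.1
      · rw [← hcN]
        exact h1.2.trans_le (hcm i.2)
    · exact h2 j hj
  · intro i
    rw [hE, volume_box, ← Finset.mul_prod_erase _ _ (Finset.mem_univ j₀),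
      Finset.prod_congr rfl (g := fun _ => ENNReal.ofReal L) fun j hj => by
        simp [ha, hb, Finset.ne_of_mem_erase hj], Finset.prod_const,
      Finset.card_erase_of_mem (Finset.mem_univ _), Finset.card_univ, Fintype.card_fin,
      ← ENNReal.ofReal_pow hL.le, ← ENNReal.ofReal_mul']
    · simp only [ha, hb, Function.update_self, hcs, add_sub_cancel_left, hwi]
      congr 1
      field_simp
    · positivity
  · intro i j hij
    have hempty : E i ∩ E j = ∅ := by
      refine Set.eq_empty_iff_forall_notMem.2 ?_
      rintro x ⟨h1, h2⟩
      exact Set.disjoint_left.1 (hcm.pairwise_disjoint_on_Ico_succ fun h => hij (Fin.ext h))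
        ((hmem i x).1 h1).1 ((hmem j x).1 h2).1
    rw [hempty, measure_empty]
  · have hempty : D \ ⋃ i, E i = ∅ := by
      refine Set.sdiff_eq_empty.2 fun x hx => ?_
      have hx0 := hx j₀
      have hex : ∃ n, x j₀ < c n := ⟨N, by rw [hcN]; exact hx0.2⟩
      classical
      obtain ⟨n, hn⟩ : ∃ n, Nat.find hex = n + 1 := by
        refine Nat.exists_eq_succ_of_ne_zero fun h0 => ?_
        have := Nat.find_spec hex
        rw [h0, hc0] at this
        exact absurd hx0.1 this.not_ge
      have h1 : x j₀ < c (n + 1) := hn ▸ Nat.find_spec hex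
      have h2 : c n ≤ x j₀ := not_lt.1 (Nat.find_min hex (by omega))
      have hnN : n < N := by
        have : Nat.find hex ≤ N := Nat.find_min' hex (by rw [hcN]; exact hx0.2)
        omega
      exact Set.mem_iUnion.2 ⟨⟨n, hnN⟩, (hmem _ _).2 ⟨⟨h2, h1⟩, fun j _ => hx j⟩⟩
    rw [hempty, measure_empty]
  · exact ENNReal.sum_ne_top.2 fun i _ => (nlPer_box_lt_top hK _ _).ne

theorem stmt5 {d : ℕ} (hd : 1 ≤ d) (s C : ℝ) (hs : s ∈ Set.Ioo (0:ℝ) 1) (hC : 0 < C)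
    (K : Vd d → ℝ≥0∞) (hK : IsKernel s C K)
    (L : ℝ) (hL : 0 < L) (N : ℕ) (v : Fin N → ℝ) (hv : ∀ i, 0 < v i)
    (hsum : ∑ i, v i = L ^ d)
    (G : Set (Vd d)) (hG : IsLatticeWithVol G (L ^ d))
    (D : Set (Vd d)) (hD : IsFundDom G D)
    (E : Fin N → Set (Vd d)) (hE : AdmissiblePart D v E)
    (hmin : (2⁻¹ * ∑ i, nlPer K (E i)) =
      sInf {c : ℝ≥0∞ | ∃ (G' D' : Set (Vd d)) (E' : Fin N → Set (Vd d)),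
        IsLatticeWithVol G' (L ^ d) ∧ IsFundDom G' D' ∧ AdmissiblePart D' v E' ∧
        c = 2⁻¹ * ∑ i, nlPer K (E' i)})
    (r : ℝ) (hr0 : 0 < r) (hr : r < packingRadius G / 2) (x : Vd d) :
    IsVolConstrMin K (phiK K (packingRadius G - 2 * r)) (Metric.ball x r)
      (fun p : Fin N × ↥G => setTranslate ((p.2 : Vd d)) (E p.1)) := by
  obtain ⟨bas, -, hGb, -⟩ := id hG
  obtain ⟨H, hHb, hcount⟩ := exists_addSubgroup_of_latticeOf bas
  obtain rfl : (H : Set (Vd d)) = G := hHb.trans hGb.symm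
  have hKm := hK.1.1
  set Ω : Set (Vd d) := Metric.ball x r
  have hΩ : MeasurableSet Ω := measurableSet_ball
  have hfar : ∀ (g h : H) (y z : Vd d), g ≠ h → y + (g : Vd d) ∈ Ω → z + (h : Vd d) ∈ Ω →
      packingRadius (H : Set (Vd d)) - 2 * r ≤ dist y z := by
    intro g h y z hgh hy hz
    have h1 := packingRadius_le_dist g.2 h.2 fun h => hgh (Subtype.ext h)
    have h2 : dist (g : Vd d) h ≤ dist (y + (g : Vd d)) (z + (h : Vd d)) + dist y z := by
      have h3 : (g : Vd d) - h = (y + g - (z + h)) - (y - z) := by abel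
      rw [dist_eq_norm, dist_eq_norm, dist_eq_norm, h3]
      exact norm_sub_le _ _
    have h4 := dist_triangle_right (y + (g : Vd d)) (z + (h : Vd d)) x
    linarith [Metric.mem_ball.1 hy, Metric.mem_ball.1 hz]
  have hdis : ∀ (g h : H) (y : Vd d), y + (g : Vd d) ∈ Ω → y + (h : Vd d) ∈ Ω → g = h := by
    intro g h y hg hh
    by_contra hgh
    have := hfar g h y y hgh hg hh
    rw [dist_self] at this
    linarith
  have hle : ∀ (G' D' : Set (Vd d)) (E' : Fin N → Set (Vd d)), IsLatticeWithVol G' (L ^ d) →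
      IsFundDom G' D' → AdmissiblePart D' v E' → ∑ i, nlPer K (E i) ≤ ∑ i, nlPer K (E' i) := by
    intro G' D' E' h1 h2 h3
    have h4 : 2⁻¹ * ∑ i, nlPer K (E i) ≤ 2⁻¹ * ∑ i, nlPer K (E' i) :=
      hmin.trans_le (sInf_le ⟨G', D', E', h1, h2, h3, rfl⟩)
    exact (ENNReal.mul_le_mul_iff_right (by simp) (by simp)).1 h4
  have hfin : ∑ i, nlPer K (E i) ≠ ⊤ := by
    obtain ⟨G', D', E', h1, h2, h3, h4⟩ := exists_admissible_nlPer_ne_top hd hK.1 hL hv hsum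
    exact ne_top_of_le_ne_top h4 (hle G' D' E' h1 h2 h3)
  refine ⟨sum_tsum_nlPerRel_translate_ne_top hKm hΩ hdis hE.1 hfin, fun B hB hcc hvol => ?_⟩
  have hBE : ∀ i (g : H) (y : Vd d), y + (g : Vd d) ∉ Ω →
      (y + (g : Vd d) ∈ B (i, g) ↔ y ∈ E i) := by
    intro i g y hy
    have h1 : y + (g : Vd d) ∉ setTranslate (g : Vd d) (E i) ∆ B (i, g) := fun h =>
      hy ((hcc (i, g)).2 (subset_closure h))
    rw [Set.mem_symmDiff, mem_setTranslate] at h1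
    tauto
  set F : Fin N → Set (Vd d) := fun i => periodize H Ω (E i) fun g => B (i, g)
  have hFm : ∀ i, MeasurableSet (F i) := fun i =>
    measurableSet_periodize hΩ (hE.1 i) fun g => hB.1 _
  obtain ⟨hFD, hFdisj⟩ := isFundDom_iUnion_of_isPartition hFm
    (isPartition_periodize hΩ hdis hE.1 hB (isPartition_translates hD hE))
  have hFadm : AdmissiblePart (⋃ i, F i) v F :=
    ⟨hFm, Set.subset_iUnion F,
      fun i => (volume_periodize hΩ hdis fun g => hvol (i, g)).trans (hE.2.2.1 i), hFdisj,
      by rw [Set.sdiff_self, measure_empty]⟩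
  exact sum_tsum_nlPerRel_translate_le hKm hΩ hdis hfar hE.1 hFm hB.1
    (fun _ _ _ => mem_periodize_of_mem hdis) (fun _ _ => mem_periodize_of_notMem) hBE hfin
    (hle _ _ F hG hFD hFadm)

end
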